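/- Each piece Xᵢ (i = 0, 1, 2) of the geometrically standard 0-trisection of the closed unit ball B⁴ ⊆ ℝ⁴ is compact, connected, and homeomorphic (with its subspace topology) to the closed unit ball in ℝ⁴. -/

import Mathlib

/-- The piece `Xᵢ` of the geometrically standard 0-trisection of the unit ball
`B⁴ ⊆ ℝ⁴`: points of the ball whose first two coordinates either vanish or have
polar angle in `[2πi/3, 2π(i+1)/3]` (angles taken mod `2π`). -/
def trisectionPiece (i : ℕ) : Set (EuclideanSpace ℝ (Fin 4)) :=
  {x | (x 0) ^ 2 + (x 1) ^ 2 + (x 2) ^ 2 + (x 3) ^ 2 ≤ 1 ∧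
    ((x 0 = 0 ∧ x 1 = 0) ∨
      ∃ r θ : ℝ, 0 < r ∧
        2 * Real.pi / 3 * (i : ℝ) ≤ θ ∧ θ ≤ 2 * Real.pi / 3 * ((i : ℝ) + 1) ∧
        x 0 = r * Real.cos θ ∧ x 1 = r * Real.sin θ)}

/-- The planar sector of opening angle `2π/3` starting at the angle `α` is an intersection of two
half-planes. -/
theorem sector_iff (α a b : ℝ) :
    ((a = 0 ∧ b = 0) ∨ ∃ r θ : ℝ, 0 < r ∧ α ≤ θ ∧ θ ≤ α + 2 * Real.pi / 3 ∧
      a = r * Real.cos θ ∧ b = r * Real.sin θ) ↔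
    0 ≤ Real.cos α * b - Real.sin α * a ∧
      0 ≤ Real.sin (α + 2 * Real.pi / 3) * a - Real.cos (α + 2 * Real.pi / 3) * b := by
  have hpi := Real.pi_pos
  constructor
  · rintro (⟨rfl, rfl⟩ | ⟨r, θ, hr, h₁, h₂, rfl, rfl⟩)
    · simp
    · have e₁ : Real.cos α * (r * Real.sin θ) - Real.sin α * (r * Real.cos θ)
          = r * Real.sin (θ - α) := by rw [Real.sin_sub]; ring
      have e₂ (β : ℝ) : Real.sin β * (r * Real.cos θ) - Real.cos β * (r * Real.sin θ)
          = r * Real.sin (β - θ) := by rw [Real.sin_sub]; ring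
      rw [e₁, e₂]
      exact ⟨mul_nonneg hr.le (Real.sin_nonneg_of_nonneg_of_le_pi (by linarith) (by linarith)),
        mul_nonneg hr.le (Real.sin_nonneg_of_nonneg_of_le_pi (by linarith) (by linarith))⟩
  · rintro ⟨h₁, h₂⟩
    set z : ℂ := ⟨Real.cos α * a + Real.sin α * b, Real.cos α * b - Real.sin α * a⟩
    have hre : ‖z‖ * Real.cos z.arg = Real.cos α * a + Real.sin α * b :=
      Complex.norm_mul_cos_arg z
    have him : ‖z‖ * Real.sin z.arg = Real.cos α * b - Real.sin α * a :=
      Complex.norm_mul_sin_arg z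
    have hα := Real.sin_sq_add_cos_sq α
    have ha : a = ‖z‖ * Real.cos (α + z.arg) := by
      rw [Real.cos_add]
      linear_combination -a * hα - Real.cos α * hre + Real.sin α * him
    have hb : b = ‖z‖ * Real.sin (α + z.arg) := by
      rw [Real.sin_add]
      linear_combination -b * hα - Real.sin α * hre - Real.cos α * him
    rcases (norm_nonneg z).eq_or_lt with h0 | h0
    · left
      rw [← h0, zero_mul] at ha hb
      exact ⟨ha, hb⟩
    · right
      have harg : 0 ≤ z.arg := Complex.arg_nonneg_iff.2 h₁
      refine ⟨‖z‖, α + z.arg, h0, by linarith, ?_, ha, hb⟩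
      by_contra! hlt
      have hneg : Real.sin (α + 2 * Real.pi / 3 - (α + z.arg)) < 0 :=
        Real.sin_neg_of_neg_of_neg_pi_lt (by linarith) (by linarith [Complex.arg_le_pi z])
      rw [Real.sin_sub] at hneg
      have := mul_neg_of_pos_of_neg h0 hneg
      generalize Real.sin (α + 2 * Real.pi / 3) = s at *
      generalize Real.cos (α + 2 * Real.pi / 3) = c at *
      have e : ‖z‖ * (s * Real.cos (α + z.arg) - c * Real.sin (α + z.arg)) = s * a - c * b := by
        linear_combination -s * ha + c * hb
      linarith

/-- A piece of the trisection is the intersection of the unit ball with two half-spaces. -/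
theorem trisectionPiece_eq (i : ℕ) :
    trisectionPiece i = Metric.closedBall 0 1 ∩
      ({x | 0 ≤ Real.cos (2 * Real.pi / 3 * i) * x 1 - Real.sin (2 * Real.pi / 3 * i) * x 0} ∩
       {x | 0 ≤ Real.sin (2 * Real.pi / 3 * i + 2 * Real.pi / 3) * x 0 -
          Real.cos (2 * Real.pi / 3 * i + 2 * Real.pi / 3) * x 1}) := by
  ext x
  simp only [Set.mem_inter_iff, Set.mem_ofPred_eq, ← sector_iff, trisectionPiece, mul_add, mul_one]
  rw [mem_closedBall_zero_iff, ← sq_le_one_iff₀ (norm_nonneg x), EuclideanSpace.real_norm_sq_eq,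
    Fin.sum_univ_four]

theorem convex_trisectionPiece (i : ℕ) : Convex ℝ (trisectionPiece i) := by
  rw [trisectionPiece_eq]
  refine (convex_closedBall _ _).inter (Convex.inter ?_ ?_) <;>
  · apply convex_halfSpace_ge
    constructor <;> intros <;> simp <;> ring

theorem isCompact_trisectionPiece (i : ℕ) : IsCompact (trisectionPiece i) := by
  rw [trisectionPiece_eq]
  refine (isCompact_closedBall _ _).inter_right (IsClosed.inter ?_ ?_) <;>
  exact isClosed_le (by fun_prop) (by fun_prop)

theorem interior_trisectionPiece_nonempty (i : ℕ) : (interior (trisectionPiece i)).Nonempty := by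
  rw [trisectionPiece_eq]
  set α := 2 * Real.pi / 3 * (i : ℝ)
  have hs : 0 < Real.sin (Real.pi / 3) :=
    Real.sin_pos_of_pos_of_lt_pi (by positivity) (by linarith [Real.pi_pos])
  set γ := α + Real.pi / 3 with hγ
  refine ⟨!₂[Real.cos γ / 2, Real.sin γ / 2, 0, 0], mem_interior.2
    ⟨Metric.ball 0 1 ∩ ({x | 0 < Real.cos α * x 1 - Real.sin α * x 0} ∩
      {x | 0 < Real.sin (α + 2 * Real.pi / 3) * x 0 - Real.cos (α + 2 * Real.pi / 3) * x 1}),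
      ?_, ?_, ?_, ?_, ?_⟩⟩
  · exact Set.inter_subset_inter Metric.ball_subset_closedBall
      (Set.inter_subset_inter (Set.ofPred_subset_ofPred.2 fun _ ↦ le_of_lt)
        (Set.ofPred_subset_ofPred.2 fun _ ↦ le_of_lt))
  · refine Metric.isOpen_ball.inter (IsOpen.inter ?_ ?_) <;>
    exact isOpen_lt (by fun_prop) (by fun_prop)
  · rw [mem_ball_zero_iff, ← sq_lt_one_iff₀ (norm_nonneg _), EuclideanSpace.real_norm_sq_eq,
      Fin.sum_univ_four]
    simp
    nlinarith [Real.sin_sq_add_cos_sq γ]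
  · have h := Real.sin_sub γ α
    rw [show γ - α = Real.pi / 3 by ring] at h
    simp
    linarith
  · have h := Real.sin_sub (α + 2 * Real.pi / 3) γ
    rw [show α + 2 * Real.pi / 3 - γ = Real.pi / 3 by rw [hγ]; ring] at h
    simp
    linarith

/-- Each piece of the geometrically standard 0-trisection of `B⁴` is compact,
connected, and homeomorphic to the closed unit ball in `ℝ⁴`. -/
theorem trisectionPiece_compact_connected_homeo_ball (i : Fin 3) :
    IsCompact (trisectionPiece i) ∧ IsConnected (trisectionPiece i) ∧
    Nonempty ((trisectionPiece i) ≃ₜ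
      Metric.closedBall (0 : EuclideanSpace ℝ (Fin 4)) 1) := by
  obtain ⟨e, -, he, -⟩ := exists_homeomorph_image_interior_closure_frontier_eq_unitBall
    (convex_trisectionPiece i) (interior_trisectionPiece_nonempty i)
    (isCompact_trisectionPiece i).isBounded
  rw [(isCompact_trisectionPiece i).isClosed.closure_eq] at he
  exact ⟨isCompact_trisectionPiece i, (convex_trisectionPiece i).isConnected
    ((interior_trisectionPiece_nonempty i).mono interior_subset),
    ⟨(e.image _).trans (Homeomorph.setCongr he)⟩⟩
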